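/- Define the Harvey–Lawson parametrization Φ : ℝ³ → ℝ⁶, Φ(r,s,t) = (X₁,Y₁,X₂,Y₂,X₃,Y₃) with X₁ = r·cos s, Y₁ = r·sin s, X₂ = r·cos t, Y₂ = r·sin t, X₃ = r·cos(s+t), Y₃ = −r·sin(s+t) (the components of (r e^{is}, r e^{it}, r e^{−is−it}) ∈ ℂ³), and let f(r,s,t) = (r²/4)·(sin 2s + sin 2t − sin(2s+2t)). Then the pullback along Φ of the canonical one-form α = Y₁ dX₁ + Y₂ dX₂ + Y₃ dX₃ of T*ℝ³ equals df; precisely, for every point p = (r,s,t) and every tangent vector h ∈ ℝ³, Y₁(p)·(DX₁)ₚ(h) + Y₂(p)·(DX₂)ₚ(h) + Y₃(p)·(DX₃)ₚ(h) = (Df)ₚ(h), where D denotes the Fréchet derivative. In particular the Harvey–Lawson cone is an exact Lagrangian in T*ℝ³ with primitive f, and f = 0 exactly when (X₁,X₂,X₃) lies in the walls of the tetrahedral foam. -/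

import Mathlib

/-- `X`-components of the Harvey–Lawson parametrization
`(r,s,t) ↦ (r e^{is}, r e^{it}, r e^{-is-it}) ∈ ℂ³ = T*ℝ³`. -/
noncomputable def hlX1 (p : ℝ × ℝ × ℝ) : ℝ := p.1 * Real.cos p.2.1
noncomputable def hlX2 (p : ℝ × ℝ × ℝ) : ℝ := p.1 * Real.cos p.2.2
noncomputable def hlX3 (p : ℝ × ℝ × ℝ) : ℝ := p.1 * Real.cos (p.2.1 + p.2.2)

/-- `Y`-components of the Harvey–Lawson parametrization. -/
noncomputable def hlY1 (p : ℝ × ℝ × ℝ) : ℝ := p.1 * Real.sin p.2.1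
noncomputable def hlY2 (p : ℝ × ℝ × ℝ) : ℝ := p.1 * Real.sin p.2.2
noncomputable def hlY3 (p : ℝ × ℝ × ℝ) : ℝ := -(p.1 * Real.sin (p.2.1 + p.2.2))

/-- The primitive `f(r,s,t) = (r²/4)(sin 2s + sin 2t - sin(2s+2t))`. -/
noncomputable def hlF (p : ℝ × ℝ × ℝ) : ℝ :=
  p.1 ^ 2 / 4 * (Real.sin (2 * p.2.1) + Real.sin (2 * p.2.2)
    - Real.sin (2 * p.2.1 + 2 * p.2.2))

/-- The pullback of the canonical one-form `α = Y₁dX₁ + Y₂dX₂ + Y₃dX₃` of `T*ℝ³` along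
the Harvey–Lawson parametrization equals `df`: the Harvey–Lawson cone is an exact
Lagrangian with primitive `f`. -/
theorem harveyLawson_cone_exact :
    ∀ p : ℝ × ℝ × ℝ, ∃ D₁ D₂ D₃ Df : (ℝ × ℝ × ℝ) →L[ℝ] ℝ,
      HasFDerivAt hlX1 D₁ p ∧ HasFDerivAt hlX2 D₂ p ∧ HasFDerivAt hlX3 D₃ p ∧
      HasFDerivAt hlF Df p ∧
      ∀ h : ℝ × ℝ × ℝ,
        hlY1 p * D₁ h + hlY2 p * D₂ h + hlY3 p * D₃ h = Df h := by
  intro p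
  have hr : HasFDerivAt (fun q : ℝ × ℝ × ℝ => q.1) (ContinuousLinearMap.fst ℝ ℝ (ℝ × ℝ)) p :=
    hasFDerivAt_fst
  have hs : HasFDerivAt (fun q : ℝ × ℝ × ℝ => q.2.1)
      ((ContinuousLinearMap.fst ℝ ℝ ℝ).comp (ContinuousLinearMap.snd ℝ ℝ (ℝ × ℝ))) p :=
    hasFDerivAt_fst.comp p hasFDerivAt_snd
  have ht : HasFDerivAt (fun q : ℝ × ℝ × ℝ => q.2.2)
      ((ContinuousLinearMap.snd ℝ ℝ ℝ).comp (ContinuousLinearMap.snd ℝ ℝ (ℝ × ℝ))) p :=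
    hasFDerivAt_snd.comp p hasFDerivAt_snd
  have hs2 := hs.const_mul 2
  have ht2 := ht.const_mul 2
  refine ⟨_, _, _, _, hr.mul hs.cos, hr.mul ht.cos, hr.mul (hs.add ht).cos,
    ((hr.pow 2).mul_const (4 : ℝ)⁻¹).mul ((hs2.sin.add ht2.sin).sub (hs2.add ht2).sin), ?_⟩
  rintro ⟨a, b, c⟩
  obtain ⟨r, s, t⟩ := p
  have hst : 2 * s + 2 * t = 2 * (s + t) := by ring
  simp [hlY1, hlY2, hlY3, hst, Real.sin_two_mul, Real.cos_two_mul]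
  have h1 := Real.sin_sq_add_cos_sq s
  have h2 := Real.sin_sq_add_cos_sq t
  have h3 := Real.sin_sq_add_cos_sq (s + t)
  linear_combination (-r ^ 2 * b) * h1 + (-r ^ 2 * c) * h2 + (r ^ 2 * (b + c)) * h3
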